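/- arXiv:math/0408303 — 3 statements merged into one kernel-verified Lean document; each statement's English description precedes it below -/
import Mathlib

section
/- For every N≥2, the map from the symmetric group S_N to itself defined by p ↦ p·(ω_N(p))^{-1} is a bijection. -/
/-! The map `ω_N : S_N → S_N` of Molev, "Skew representations of twisted
Yangians", Section 3, and the bijectivity of `p ↦ p·(ω_N(p))⁻¹`
(Lemma 3.7).  Permutations of the symbols `c_1 < ⋯ < c_N` are represented as
permutations of `Fin N` via their one-line notation, the symbols being
`0 < 1 < ⋯ < N-1`. -/

noncomputable section

namespace TY12

/-- The map on ordered pairs of distinct symbols used in the inductive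
definition of `ω_N`; `cs` is the increasing list of the current symbols. -/
def pairmap (cs : List ℕ) (x y : ℕ) : ℕ × ℕ :=
  let cN := cs.getLastD 0
  let cN1 := cs.dropLast.getLastD 0
  let cN2 := cs.dropLast.dropLast.getLastD 0
  if x = cN1 ∧ y = cN then (cN1, cN2)
  else if x = cN ∧ y = cN1 then (cN1, cN2)
  else if y = cN then (cN1, x)
  else if x = cN then (y, cN1)
  else (y, x)

/-- The map `ω` in one-line notation: `cs` is the increasing list of symbols
and `p` a permutation of `cs`.  The image `p′` has last entry `max cs`, the
pair `(p′_1, p′_{N-1})` is the image of `(p_1, p_N)` under `pairmap cs`, and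
the remaining entries are determined inductively from the middle part of `p`
over the symbol set obtained by deleting `p_1` and `p_N`. -/
def omegaList (cs p : List ℕ) : List ℕ :=
  if p.length ≤ 1 then p
  else if p.length = 2 then cs
  else
    let x := p.headD 0
    let y := p.getLastD 0
    let xy := pairmap cs x y
    xy.1 ::
      ((omegaList ((cs.erase x).erase y) ((p.drop 1).dropLast)).dropLast
        ++ [xy.2, cs.getLastD 0])
termination_by p.length
decreasing_by
  simp only [List.length_dropLast, List.length_drop]
  omega

/-- One-line notation of a permutation of `Fin N`. -/
def oneLine {N : ℕ} (σ : Equiv.Perm (Fin N)) : List ℕ :=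
  (List.finRange N).map fun i => (σ i : ℕ)

/-- The map `ω_N : S_N → S_N`. -/
def omegaPerm (N : ℕ) (σ : Equiv.Perm (Fin N)) : Equiv.Perm (Fin N) :=
  if h : ∃ τ : Equiv.Perm (Fin N),
      oneLine τ = omegaList (List.range N) (oneLine σ)
  then h.choose else 1

end TY12

namespace TY12

theorem omegaList_of_length_le_two {cs p : List ℕ} (hp : p.Perm cs) (h : p.length ≤ 2) :
    omegaList cs p = cs := by
  rw [omegaList]
  split_ifs with h1 h2
  · rcases p with _ | ⟨x, _ | ⟨y, p⟩⟩
    · exact (List.nil_perm.1 hp).symm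
    · exact (List.singleton_perm.1 hp)
    · simp at h1
  · rfl
  · omega

theorem omegaList_cons_concat (cs : List ℕ) {x y : ℕ} {mid : List ℕ} (hmid : mid ≠ []) :
    omegaList cs (x :: (mid ++ [y])) =
      (pairmap cs x y).1 :: ((omegaList ((cs.erase x).erase y) mid).dropLast ++
        [(pairmap cs x y).2, cs.getLastD 0]) := by
  have := List.length_pos_iff.2 hmid
  rw [omegaList, if_neg (by simp), if_neg (by simp; omega)]
  simp [List.getLastD_eq_getLast?, List.getLast?_cons]

theorem exists_eq_cons_concat {p : List ℕ} (h : 2 < p.length) :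
    ∃ x mid y, mid ≠ [] ∧ p = x :: (mid ++ [y]) := by
  rcases p with _ | ⟨x, p⟩
  · simp at h
  · rcases List.eq_nil_or_concat p with rfl | ⟨mid, y, rfl⟩
    · simp at h
    · refine ⟨x, mid, y, ?_, by simp⟩
      rintro rfl
      simp at h

theorem pairmap_fst (cs : List ℕ) (x y : ℕ) :
    (pairmap cs x y).1 = if y = cs.getLastD 0 then cs.dropLast.getLastD 0 else y := by
  unfold pairmap
  grind

/-- Replacing the pair `x, y` by its image trades the largest symbol of `cs` for the largest
symbol left after deleting `x` and `y`. -/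
theorem exists_erase_erase_eq {cs : List ℕ} (hcs : cs.Nodup) (hlen : 2 < cs.length) {x y : ℕ}
    (hx : x ∈ cs) (hy : y ∈ cs) (hxy : x ≠ y) :
    ∃ es m, (cs.erase x).erase y = es ++ [m] ∧
      cs.Perm ((pairmap cs x y).1 :: (es ++ [(pairmap cs x y).2, cs.getLastD 0])) := by
  obtain ⟨ds, c₂, c₁, M, rfl⟩ : ∃ ds c₂ c₁ M, cs = ds ++ [c₂, c₁, M] := by
    rcases List.eq_nil_or_concat cs with rfl | ⟨cs, M, rfl⟩
    · simp at hlen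
    rcases List.eq_nil_or_concat cs with rfl | ⟨cs, c₁, rfl⟩
    · simp at hlen
    rcases List.eq_nil_or_concat cs with rfl | ⟨cs, c₂, rfl⟩
    · simp at hlen
    exact ⟨cs, c₂, c₁, M, by simp⟩
  have e1 : (ds ++ [c₂, c₁, M]).getLastD 0 = M := by simp [List.getLastD_eq_getLast?]
  have d1 : (ds ++ [c₂, c₁, M]).dropLast = ds ++ [c₂, c₁] := by simp
  have e2 : (ds ++ [c₂, c₁]).getLastD 0 = c₁ := by simp [List.getLastD_eq_getLast?]
  have d2 : (ds ++ [c₂, c₁]).dropLast = ds ++ [c₂] := by simp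
  have e3 : (ds ++ [c₂]).getLastD 0 = c₂ := by simp [List.getLastD_eq_getLast?]
  have hpm : pairmap (ds ++ [c₂, c₁, M]) x y = if x = c₁ ∧ y = M then (c₁, c₂)
      else if x = M ∧ y = c₁ then (c₁, c₂)
      else if y = M then (c₁, x) else if x = M then (y, c₁) else (y, x) := by
    simp only [pairmap, e1, d1, e2, d2, e3]
  have hn := hcs
  rw [List.nodup_append] at hn
  obtain ⟨-, hn, hdis⟩ := hn
  have hc₁ : c₁ ∉ ds := fun h => hdis _ h c₁ (by simp) rfl
  have hM : M ∉ ds := fun h => hdis _ h M (by simp) rfl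
  simp only [List.nodup_cons, List.mem_cons, List.not_mem_nil, or_false, not_or] at hn
  obtain ⟨⟨h21, h2M⟩, h1M, -⟩ := hn
  have memcase : ∀ z ∈ ds ++ [c₂, c₁, M], z = M ∨ z = c₁ ∨ z ∈ ds ++ [c₂] := by
    intro z hz
    simp only [List.mem_append, List.mem_cons, List.not_mem_nil, or_false] at hz ⊢
    tauto
  have h3 : ds ++ [c₂, c₁, M] = (ds ++ [c₂]) ++ [c₁] ++ [M] := by simp
  have hc₁' : c₁ ∉ ds ++ [c₂] := by simp [hc₁, Ne.symm h21]
  have hM' : M ∉ ds ++ [c₂] ++ [c₁] := by simp [hM, Ne.symm h2M, Ne.symm h1M]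
  have hM'' : M ∉ ds ++ [c₂] := by simp [hM, Ne.symm h2M]
  rw [e1, hpm, h3]
  set D := ds ++ [c₂] with hD
  have eM : (D ++ [c₁] ++ [M]).erase M = D ++ [c₁] := by
    rw [List.erase_append_right _ hM']; simp
  have ec : (D ++ [c₁]).erase c₁ = D := by
    rw [List.erase_append_right _ hc₁']; simp
  by_cases hlast : x = M ∨ y = M
  · have hz : ∃ z, z ≠ M ∧ z ∈ ds ++ [c₂, c₁, M] ∧
        ((D ++ [c₁] ++ [M]).erase x).erase y = (D ++ [c₁]).erase z ∧
        (x = M ∧ y = z ∨ y = M ∧ x = z) := by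
      rcases hlast with rfl | rfl
      · exact ⟨y, hxy.symm, hy, by rw [eM], .inl ⟨rfl, rfl⟩⟩
      · exact ⟨x, hxy, hx, by rw [List.erase_comm, eM], .inr ⟨rfl, rfl⟩⟩
    obtain ⟨z, hzM, hzm, he, hz⟩ := hz
    rw [he]
    by_cases hz1 : z = c₁
    · subst hz1
      refine ⟨ds, c₂, by rw [ec], ?_⟩
      have : (if x = z ∧ y = M then (z, c₂)
        else if x = M ∧ y = z then (z, c₂)
        else if y = M then (z, x) else if x = M then (y, z) else (y, x)) = (z, c₂) := by grind
      rw [this, List.perm_iff_count]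
      intro t
      simp only [hD, List.count_append, List.count_cons, List.count_nil]
      omega
    · have hzD : z ∈ D := by
        rcases memcase z hzm with h | h | h
        · exact absurd h hzM
        · exact absurd h hz1
        · exact h
      refine ⟨D.erase z, c₁, List.erase_append_left _ hzD, ?_⟩
      have hp := List.perm_iff_count.1 (List.perm_cons_erase hzD)
      rw [List.perm_iff_count]
      intro t
      have hp := hp t
      rcases hz with ⟨h, h'⟩ | ⟨h, h'⟩ <;> subst h <;> subst h' <;>
        simp [hz1, hxy, hxy.symm, List.count_cons] at hp ⊢ <;> omega
  · push Not at hlast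
    obtain ⟨hxM, hyM⟩ := hlast
    have mem : ∀ z ∈ ds ++ [c₂, c₁, M], z ≠ M → z ∈ D ++ [c₁] := by
      intro z hz hzM
      rcases memcase z hz with h | h | h
      · exact absurd h hzM
      · simp [h]
      · exact List.mem_append_left _ h
    have hx' := mem x hx hxM
    have hy' : y ∈ (D ++ [c₁]).erase x := (List.mem_erase_of_ne hxy.symm).2 (mem y hy hyM)
    refine ⟨((D ++ [c₁]).erase x).erase y, M, ?_, ?_⟩
    · rw [List.erase_append_left _ hx', List.erase_append_left _ hy']
    · have hp := List.perm_iff_count.1 (List.perm_cons_erase hx')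
      have hp' := List.perm_iff_count.1 (List.perm_cons_erase hy')
      rw [List.perm_iff_count]
      intro t
      have hp := hp t
      have hp' := hp' t
      simp only [hxM, hyM, and_false, false_and, if_false]
      rw [List.count_cons] at hp hp'
      rw [List.count_append, hp, hp']
      simp only [List.count_append, List.count_cons, List.count_nil]
      omega

theorem mid_perm_erase_erase {cs mid : List ℕ} {x y : ℕ} (hp : (x :: (mid ++ [y])).Perm cs) :
    mid.Perm ((cs.erase x).erase y) := by
  have h := (hp.erase x).erase y
  rw [List.erase_cons_head] at h
  refine List.Perm.trans ?_ h
  have : (y :: mid).Perm (mid ++ [y]) := (List.perm_append_singleton y mid).symm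
  simpa using this.erase y

theorem ne_of_nodup_cons_concat {mid : List ℕ} {x y : ℕ} (h : (x :: (mid ++ [y])).Nodup) :
    x ≠ y := by
  rintro rfl
  simp at h

/-- `omegaList cs p` rearranges `cs`, with the same last entry. -/
theorem omegaList_perm {cs p : List ℕ} (hcs : cs.Nodup) (hp : p.Perm cs) :
    (omegaList cs p).Perm cs ∧ (omegaList cs p).getLastD 0 = cs.getLastD 0 := by
  induction hn : p.length using Nat.strong_induction_on generalizing cs p with
  | _ n ih =>
    by_cases h : p.length ≤ 2
    · simp [omegaList_of_length_le_two hp h]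
    · obtain ⟨x, mid, y, hmid, rfl⟩ := exists_eq_cons_concat (by omega : 2 < p.length)
      obtain ⟨es, m, he, hperm⟩ := exists_erase_erase_eq hcs (by rw [← hp.length_eq]; omega)
        (x := x) (y := y) (hp.subset (by simp)) (hp.subset (by simp))
        (ne_of_nodup_cons_concat (hp.nodup_iff.2 hcs))
      obtain ⟨hw, hl⟩ := ih mid.length (by simp at hn; omega) ((hcs.erase x).erase y)
        (mid_perm_erase_erase hp) rfl
      rw [omegaList_cons_concat cs hmid]
      refine ⟨?_, by simp [List.getLastD_eq_getLast?, List.getLast?_cons]⟩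
      rw [he] at hw hl ⊢
      refine List.Perm.trans (List.Perm.cons _ (List.Perm.append_right _ ?_)) hperm.symm
      generalize omegaList (es ++ [m]) mid = w at hw hl
      rcases List.eq_nil_or_concat w with rfl | ⟨w, k, rfl⟩
      · simpa using hw.length_eq
      · have hk : k = m := by simpa [List.getLastD_eq_getLast?] using hl
        subst hk
        simpa [List.perm_append_right_iff] using hw

theorem exists_omegaList_eq_concat {cs p es : List ℕ} {m : ℕ} (hcs : cs.Nodup) (hp : p.Perm cs)
    (he : cs = es ++ [m]) : ∃ w, omegaList cs p = w ++ [m] ∧ m ∉ w := by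
  obtain ⟨hw, hl⟩ := omegaList_perm hcs hp
  have hnd := hw.nodup_iff.2 hcs
  subst he
  generalize omegaList (es ++ [m]) p = w at hw hl hnd
  rcases List.eq_nil_or_concat w with rfl | ⟨w, k, rfl⟩
  · simpa using hw.length_eq
  · have hk : k = m := by simpa [List.getLastD_eq_getLast?] using hl
    subst hk
    refine ⟨w, by simp, fun h => ?_⟩
    rw [List.concat_eq_append, List.nodup_append] at hnd
    exact hnd.2.2 _ h _ (by simp) rfl

theorem map_update_omegaList {cs mid es : List ℕ} {x y m : ℕ} {q : ℕ → ℕ} (hcs : cs.Nodup)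
    (hp : (x :: (mid ++ [y])).Perm cs) (hmid : mid ≠ [])
    (he : (cs.erase x).erase y = es ++ [m])
    (hq : (omegaList cs (x :: (mid ++ [y]))).map q = x :: (mid ++ [y])) :
    q (pairmap cs x y).1 = x ∧ q (cs.getLastD 0) = y ∧
      (omegaList (es ++ [m]) mid).map (Function.update q m (q (pairmap cs x y).2)) = mid := by
  obtain ⟨w, hw, hmw⟩ := exists_omegaList_eq_concat ((hcs.erase x).erase y)
    (mid_perm_erase_erase hp) he
  rw [omegaList_cons_concat cs hmid, hw, List.dropLast_concat] at hq
  rw [he] at hw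
  simp only [List.map_cons, List.map_append, List.map_nil, List.cons.injEq] at hq
  obtain ⟨h1, h2⟩ := hq
  have h2' : (w.map q ++ [q (pairmap cs x y).2]) ++ [q (cs.getLastD 0)] = mid ++ [y] := by
    simpa using h2
  obtain ⟨h3, h4⟩ := List.append_inj' h2' rfl
  refine ⟨h1, by simpa using h4, ?_⟩
  rw [hw, List.map_append, ← h3]
  congr 1
  · refine List.map_congr_left fun a ha => Function.update_of_ne ?_ _ _
    rintro rfl
    exact hmw ha
  · simp

/-- A permutation `p` of `cs` is determined by the map sending each entry of `omegaList cs p` to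
the corresponding entry of `p`. -/
theorem eq_of_map_omegaList_eq {cs p r : List ℕ} {q : ℕ → ℕ} (hcs : cs.Nodup) (hp : p.Perm cs)
    (hr : r.Perm cs) (hpq : (omegaList cs p).map q = p) (hrq : (omegaList cs r).map q = r) :
    p = r := by
  induction hn : p.length using Nat.strong_induction_on generalizing cs p r q with
  | _ n ih =>
    have hlen : p.length = r.length := hp.length_eq.trans hr.length_eq.symm
    by_cases h : p.length ≤ 2
    · rw [omegaList_of_length_le_two hp h] at hpq
      rw [omegaList_of_length_le_two hr (hlen ▸ h)] at hrq
      exact hpq.symm.trans hrq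
    · obtain ⟨x, mid, y, hmid, rfl⟩ := exists_eq_cons_concat (by omega : 2 < p.length)
      obtain ⟨x', mid', y', hmid', rfl⟩ := exists_eq_cons_concat (by omega : 2 < r.length)
      have hmem : ∀ {u v mid}, (u :: (mid ++ [v])).Perm cs → ∃ es m,
          (cs.erase u).erase v = es ++ [m] := by
        intro u v mid hp'
        obtain ⟨es, m, he, -⟩ := exists_erase_erase_eq hcs (by rw [← hp.length_eq]; omega)
          (x := u) (y := v) (hp'.subset (by simp)) (hp'.subset (by simp))
          (ne_of_nodup_cons_concat (hp'.nodup_iff.2 hcs))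
        exact ⟨es, m, he⟩
      obtain ⟨es, m, he⟩ := hmem hp
      obtain ⟨es', m', he'⟩ := hmem hr
      obtain ⟨h1, h2, h3⟩ := map_update_omegaList hcs hp hmid he hpq
      obtain ⟨h1', h2', h3'⟩ := map_update_omegaList hcs hr hmid' he' hrq
      obtain rfl : y = y' := h2.symm.trans h2'
      rw [pairmap_fst] at h1 h1'
      obtain rfl : x = x' := h1.symm.trans h1'
      obtain ⟨rfl, hm⟩ := List.append_inj' (he.symm.trans he') rfl
      obtain rfl : m = m' := by simpa using hm
      have hes : (es ++ [m]).Nodup := he ▸ (hcs.erase x).erase y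
      rw [ih mid.length (by simp at hn; omega) hes (he ▸ mid_perm_erase_erase hp)
        (he ▸ mid_perm_erase_erase hr) h3 h3' rfl]

theorem oneLine_injective {N : ℕ} :
    Function.Injective (oneLine : Equiv.Perm (Fin N) → List ℕ) := by
  intro σ τ h
  ext i
  exact List.map_inj_left.1 h i (List.mem_finRange i)

theorem oneLine_perm_range {N : ℕ} (σ : Equiv.Perm (Fin N)) :
    (oneLine σ).Perm (List.range N) := by
  rw [List.perm_ext_iff_of_nodup _ List.nodup_range]
  · intro a
    simp only [oneLine, List.mem_map, List.mem_finRange, true_and, List.mem_range]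
    constructor
    · rintro ⟨i, rfl⟩
      exact (σ i).isLt
    · exact fun h => ⟨σ.symm ⟨a, h⟩, by simp⟩
  · exact (List.nodup_finRange N).map (Fin.val_injective.comp σ.injective)

theorem exists_oneLine_eq {N : ℕ} {l : List ℕ} (hl : l.Perm (List.range N)) :
    ∃ τ : Equiv.Perm (Fin N), oneLine τ = l := by
  have hlen : l.length = N := by simpa using hl.length_eq
  have hnd : l.Nodup := hl.nodup_iff.2 List.nodup_range
  let f : Fin N → Fin N := fun i =>
    ⟨l[i.1]'(by omega), List.mem_range.1 (hl.subset (List.getElem_mem _))⟩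
  have hf : Function.Injective f := by
    intro i j hij
    have : l[i.1]'(by omega) = l[j.1]'(by omega) := congrArg Fin.val hij
    exact Fin.ext ((hnd.getElem_inj_iff).1 this)
  refine ⟨Equiv.ofBijective f (Finite.injective_iff_bijective.1 hf), ?_⟩
  apply List.ext_getElem
  · simp [oneLine, hlen]
  · intro i h1 h2
    simp [oneLine, f]

theorem oneLine_omegaPerm {N : ℕ} (σ : Equiv.Perm (Fin N)) :
    oneLine (omegaPerm N σ) = omegaList (List.range N) (oneLine σ) := by
  have h := exists_oneLine_eq (omegaList_perm List.nodup_range (oneLine_perm_range σ)).1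
  rw [omegaPerm, dif_pos h]
  exact h.choose_spec

theorem map_omegaList_oneLine {N : ℕ} {σ π : Equiv.Perm (Fin N)}
    (h : σ * (omegaPerm N σ)⁻¹ = π) :
    (omegaList (List.range N) (oneLine σ)).map
      (fun n => if hn : n < N then (π ⟨n, hn⟩ : ℕ) else 0) = oneLine σ := by
  rw [← oneLine_omegaPerm, oneLine, List.map_map, oneLine]
  refine List.map_congr_left fun i _ => ?_
  simp [← h]

end TY12

/-- Lemma 3.7: for every `N ≥ 2`, the map `p ↦ p·(p′)⁻¹`,
where `p′ = ω_N(p)`, is a bijection of the symmetric group `S_N`. -/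
theorem statement_12 (N : ℕ) (hN : 2 ≤ N) :
    Function.Bijective
      (fun σ : Equiv.Perm (Fin N) => σ * (TY12.omegaPerm N σ)⁻¹) := by
  refine Finite.injective_iff_bijective.1 fun σ τ h => TY12.oneLine_injective ?_
  exact TY12.eq_of_map_omegaList_eq List.nodup_range (TY12.oneLine_perm_range σ)
    (TY12.oneLine_perm_range τ) (TY12.map_omegaList_oneLine h) (TY12.map_omegaList_oneLine rfl)
end
end

section
/- Assume at least one trapezium pattern with top row λ and bottom row μ exists. Let Λ_0 be the array with entries λ_{ki} = mid{λ_i, μ_{i+k−m}, μ_{i+m−k}} and λ′_{ki} = mid{λ_i, μ_{i+k−m−1}, μ_{i+m−k}} for all admissible k and i. Then Λ_0 is a trapezium pattern with top row λ and bottom row μ, and for every trapezium pattern Λ with top row λ and bottom row μ one has w(Λ) ≼ w(Λ_0); in particular, the set of weights of such patterns has a unique maximal element, namely w(Λ_0). -/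
/-! Trapezium Gelfand–Tsetlin-type patterns for `sp_{2n} ⊃ sp_{2m}` and the
maximality of the weight of the distinguished pattern `Λ₀`
(Molev, "Skew representations of twisted Yangians", Proposition 4.4). -/

noncomputable section

open scoped BigOperators

attribute [local instance] Classical.propDecidable

namespace TY16

/-- `μ_j` with the convention `μ_j = 0` for `j ≤ 0` (finite values only). -/
def muV (mu : ℤ → ℤ) (j : ℤ) : ℤ := if j ≤ 0 then 0 else mu j

/-- `μ_j` with the conventions `μ_j = 0` for `j ≤ 0` and `μ_j = -∞` (encoded
as `none`) for `j > m`. -/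
def muE (m : ℤ) (mu : ℤ → ℤ) (j : ℤ) : Option ℤ :=
  if m < j then none else some (muV mu j)

/-- `mid{x,y,z}`: the middle one of three values, the second of which may be
`-∞`, with the convention `mid{x,-∞,z} = min x z`. -/
def mid3 (x : ℤ) (y : Option ℤ) (z : ℤ) : ℤ :=
  y.elim (min x z) fun y' =>
    x + y' + z - max x (max y' z) - min x (min y' z)

/-- A trapezium pattern `Λ` with top row `λ` and bottom row `μ`: rows
`λ'_k = (λ'_{k1},…,λ'_{kk})` for `k = m+1,…,n` (the function `lp`) and rows
`λ_k = (λ_{k1},…,λ_{kk})` for `k = m,…,n` (the function `L`) with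
`λ_{mi} = μ_i` and `λ_{ni} = λ_i`, subject to the betweenness conditions. -/
def IsTrap (n m : ℤ) (lam mu : ℤ → ℤ) (L lp : ℤ → ℤ → ℤ) : Prop :=
  (∀ i : ℤ, 1 ≤ i → i ≤ m → L m i = mu i) ∧
  (∀ i : ℤ, 1 ≤ i → i ≤ n → L n i = lam i) ∧
  (∀ k : ℤ, m+1 ≤ k → k ≤ n → lp k 1 ≤ 0) ∧
  (∀ k : ℤ, m+1 ≤ k → k ≤ n → ∀ i : ℤ, 1 ≤ i → i ≤ k → L k i ≤ lp k i) ∧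
  (∀ k : ℤ, m+1 ≤ k → k ≤ n → ∀ i : ℤ, 1 ≤ i → i ≤ k-1 → lp k (i+1) ≤ L k i) ∧
  (∀ k : ℤ, m+1 ≤ k → k ≤ n → ∀ i : ℤ, 1 ≤ i → i ≤ k-1 → L (k-1) i ≤ lp k i) ∧
  (∀ k : ℤ, m+1 ≤ k → k ≤ n → ∀ i : ℤ, 1 ≤ i → i ≤ k-1 → lp k (i+1) ≤ L (k-1) i)

/-- The weight `w(Λ) = (w_{m+1},…,w_n)`,
`w_k = 2 Σ λ'_{ki} - Σ λ_{ki} - Σ λ_{k-1,i}`. -/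
def wt (L lp : ℤ → ℤ → ℤ) (k : ℤ) : ℤ :=
  2 * (∑ i ∈ Finset.Icc 1 k, lp k i)
    - (∑ i ∈ Finset.Icc 1 k, L k i)
    - (∑ i ∈ Finset.Icc 1 (k-1), L (k-1) i)

/-- The dominance order on weights: `w ≼ w'` iff `w' - w` is a nonnegative
integral combination of the positive roots `ε_i - ε_j` (`i < j`) and
`-ε_i - ε_j` (`i ≤ j`) of `sp_{2(n-m)}` (coordinates indexed by
`m+1,…,n`). -/
def wle (m n : ℤ) (w w' : ℤ → ℤ) : Prop :=
  ∃ c d : ℤ × ℤ → ℕ,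
    ∀ k : ℤ, m+1 ≤ k → k ≤ n →
      w' k - w k
        = (∑ p ∈ ((Finset.Icc (m+1) n) ×ˢ (Finset.Icc (m+1) n)).filter
              (fun p => p.1 < p.2),
            (c p : ℤ) * ((if k = p.1 then 1 else 0) - (if k = p.2 then 1 else 0)))
          + (∑ p ∈ ((Finset.Icc (m+1) n) ×ˢ (Finset.Icc (m+1) n)).filter
              (fun p => p.1 ≤ p.2),
            (d p : ℤ) * (-(if k = p.1 then 1 else 0) - (if k = p.2 then 1 else 0)))

/-- The rows `λ_{ki} = mid{λ_i, μ_{i+k-m}, μ_{i+m-k}}` of the pattern `Λ₀`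
(with the boundary rows `λ_m = μ`, `λ_n = λ`). -/
def L0 (n m : ℤ) (lam mu : ℤ → ℤ) : ℤ → ℤ → ℤ := fun k i =>
  if k = n then lam i
  else if k = m then mu i
  else mid3 (lam i) (muE m mu (i+k-m)) (muV mu (i+m-k))

/-- The rows `λ'_{ki} = mid{λ_i, μ_{i+k-m-1}, μ_{i+m-k}}` of the pattern `Λ₀`. -/
def lp0 (m : ℤ) (lam mu : ℤ → ℤ) : ℤ → ℤ → ℤ := fun k i =>
  mid3 (lam i) (muE m mu (i+k-m-1)) (muV mu (i+m-k))

end TY16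

open TY16

namespace TY16

/-- Tail-sum criterion for `wle`. -/
lemma wle_of_tail_sums {m n : ℤ} (hmn : m < n) {w w' : ℤ → ℤ}
    (htail : ∀ j : ℤ, m ≤ j → j ≤ n →
      ∑ k ∈ Finset.Icc (j + 1) n, w' k ≤ ∑ k ∈ Finset.Icc (j + 1) n, w k)
    (heven : (2 : ℤ) ∣ ∑ k ∈ Finset.Icc (m + 1) n, w k - ∑ k ∈ Finset.Icc (m + 1) n, w' k) :
    wle m n w w' := by
  set T : ℤ → ℤ := fun j => ∑ k ∈ Finset.Icc (j + 1) n, w k - ∑ k ∈ Finset.Icc (j + 1) n, w' k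
    with hT
  have hT0 : ∀ j, m ≤ j → j ≤ n → 0 ≤ T j := fun j h1 h2 => sub_nonneg.2 (htail j h1 h2)
  have hTn : T n = 0 := by simp [hT]
  have hstep : ∀ k, k ≤ n → w' k - w k = T k - T (k - 1) := by
    intro k hk
    have hI : Finset.Icc k n = insert k (Finset.Icc (k + 1) n) := by
      ext x; simp only [Finset.mem_Icc, Finset.mem_insert]; omega
    have hk' : k ∉ Finset.Icc (k + 1) n := by simp
    simp only [hT, sub_add_cancel, hI, Finset.sum_insert hk']
    ring
  obtain ⟨a, ha⟩ := heven
  have haT : T m = 2 * a := ha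
  have ha0 : 0 ≤ a := by have := hT0 m le_rfl hmn.le; omega
  set c : ℤ × ℤ → ℕ := fun p => if m + 1 ≤ p.1 ∧ p.2 = p.1 + 1 then (T p.1).toNat else 0 with hc
  set d : ℤ × ℤ → ℕ := fun p => if p = (m + 1, m + 1) then a.toNat else 0 with hd
  refine ⟨c, d, fun k hk1 hk2 => ?_⟩
  have hfst : ∑ p ∈ ((Finset.Icc (m+1) n) ×ˢ (Finset.Icc (m+1) n)).filter (fun p => p.1 < p.2),
      (c p : ℤ) * (if k = p.1 then 1 else 0) = T k := by
    rw [Finset.sum_eq_single (k, k + 1)]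
    · simp only [hc, hk1, and_self, if_true, mul_one, Int.toNat_of_nonneg (hT0 k (by omega) hk2)]
    · rintro ⟨x, y⟩ - hne
      by_cases hx : k = x
      · subst hx
        have : ¬ y = k + 1 := fun h => hne (by rw [h])
        simp [hc, this]
      · simp [hx]
    · intro hmem
      have : k = n := by
        simp only [Finset.mem_filter, Finset.mem_product, Finset.mem_Icc] at hmem
        omega
      subst this
      simp [hc, hTn]
  have hsnd : ∑ p ∈ ((Finset.Icc (m+1) n) ×ˢ (Finset.Icc (m+1) n)).filter (fun p => p.1 < p.2),
      (c p : ℤ) * (if k = p.2 then 1 else 0) = if k = m + 1 then 0 else T (k - 1) := by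
    rw [Finset.sum_eq_single (k - 1, k)]
    · by_cases h : k = m + 1
      · simp [hc, h]
      · have h' : m + 1 ≤ k - 1 := by omega
        simp only [hc, h, h', sub_add_cancel, and_self, if_true, if_false, mul_one,
          Int.toNat_of_nonneg (hT0 (k - 1) (by omega) (by omega))]
    · rintro ⟨x, y⟩ - hne
      by_cases hy : k = y
      · subst hy
        have : ¬ k = x + 1 := fun h => hne (by rw [h]; simp)
        simp [hc, this]
      · simp [hy]
    · intro hmem
      have : k = m + 1 := by
        simp only [Finset.mem_filter, Finset.mem_product, Finset.mem_Icc] at hmem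
        omega
      simp [hc, this]
  have hlong : ∑ p ∈ ((Finset.Icc (m+1) n) ×ˢ (Finset.Icc (m+1) n)).filter (fun p => p.1 ≤ p.2),
      (d p : ℤ) * (-(if k = p.1 then 1 else 0) - (if k = p.2 then 1 else 0))
        = if k = m + 1 then - T m else 0 := by
    rw [Finset.sum_eq_single (m + 1, m + 1)]
    · by_cases h : k = m + 1
      · simp [hd, h, haT, ha0]; ring
      · simp [h]
    · intro p _ hne
      simp [hd, hne]
    · intro hmem
      simp only [Finset.mem_filter, Finset.mem_product, Finset.mem_Icc] at hmem
      omega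
  rw [hlong, hstep k hk2]
  simp only [mul_sub, Finset.sum_sub_distrib, hfst, hsnd]
  split_ifs with h
  · subst h; simp; ring
  · ring

/-- The sequence `μ` extended by `0` to indices `j ≤ 0` and by a value `b`, playing the role
of `-∞`, to indices `j > m`. -/
def muExt (m b : ℤ) (mu : ℤ → ℤ) (j : ℤ) : ℤ :=
  if m < j then b else muV mu j

lemma muExt_antitone {m b : ℤ} {mu : ℤ → ℤ} (hm : 0 ≤ m) (hmu0 : mu 1 ≤ 0)
    (hmu : ∀ i : ℤ, 1 ≤ i → i < m → mu (i + 1) ≤ mu i) (hb : b ≤ muV mu m) :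
    Antitone (muExt m b mu) := by
  refine antitone_int_of_succ_le fun j => ?_
  unfold muExt
  rcases lt_trichotomy j m with h | rfl | h
  · rw [if_neg (by omega), if_neg (by omega)]
    unfold muV
    rcases lt_trichotomy j 0 with h0 | rfl | h0
    · rw [if_pos (by omega), if_pos (by omega)]
    · simpa using hmu0
    · rw [if_neg (by omega), if_neg (by omega)]
      exact hmu j (by omega) h
  · simpa using hb
  · rw [if_pos (by omega), if_pos h]

lemma muExt_of_nonpos {m b j : ℤ} {mu : ℤ → ℤ} (hm : 0 ≤ m) (hj : j ≤ 0) : muExt m b mu j = 0 := by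
  simp [muExt, muV, hj, show ¬ m < j by omega]

lemma muExt_of_mem {m b j : ℤ} {mu : ℤ → ℤ} (h1 : 1 ≤ j) (hj : j ≤ m) : muExt m b mu j = mu j := by
  simp [muExt, muV, show ¬ m < j by omega, show ¬ j ≤ 0 by omega]

/-- With a sufficiently small `b`, `mid` is a truncation to an interval. -/
lemma mid3_eq_clamp {m b x j j' : ℤ} {mu : ℤ → ℤ} (hanti : Antitone (muExt m b mu))
    (hbx : b ≤ x) (hj' : j' ≤ m) (hjj : j' ≤ j) :
    mid3 x (muE m mu j) (muV mu j') = max (muExt m b mu j) (min x (muExt m b mu j')) := by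
  have hle := hanti hjj
  have e' : muV mu j' = muExt m b mu j' := by simp [muExt, show ¬ m < j' by omega]
  rw [e']
  by_cases h : m < j
  · have e : muExt m b mu j = b := by simp [muExt, h]
    simp only [mid3, muE, if_pos h, Option.elim]
    omega
  · have e : muV mu j = muExt m b mu j := by simp [muExt, h]
    simp only [mid3, muE, if_neg h, Option.elim, e]
    omega

section Pattern

variable {n m : ℤ} {lam mu : ℤ → ℤ} {L lp : ℤ → ℤ → ℤ}

lemma IsTrap.le_muExt (h : IsTrap n m lam mu L lp) (hm : 0 ≤ m) (b : ℤ) (k : ℤ) (hk : m ≤ k) :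
    k ≤ n → ∀ i, 1 ≤ i → i ≤ k → L k i ≤ muExt m b mu (i + m - k) := by
  obtain ⟨h1, -, h3, h4, -, -, h7⟩ := h
  induction k, hk using Int.leInduction with
  | base =>
    intro _ i hi hik
    rw [h1 i hi hik, show i + m - m = i by ring, muExt_of_mem hi hik]
  | succ k hk ih =>
    intro hkn i hi hik
    have a := h4 (k + 1) (by omega) hkn i hi hik
    rcases eq_or_lt_of_le hi with rfl | hi'
    · rw [muExt_of_nonpos hm (by omega)]
      exact a.trans (h3 _ (by omega) hkn)
    · have a' := h7 (k + 1) (by omega) hkn (i - 1) (by omega) (by omega)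
      have a'' := ih (by omega) (i - 1) (by omega) (by omega)
      rw [show k + 1 - 1 = k by ring, show i - 1 + 1 = i by ring] at a'
      rw [show i - 1 + m - k = i + m - (k + 1) by ring] at a''
      omega

lemma IsTrap.muExt_le (h : IsTrap n m lam mu L lp) (b : ℤ) (k : ℤ) (hk : m ≤ k) :
    k ≤ n → ∀ i, 1 ≤ i → i + k - m ≤ m → muExt m b mu (i + k - m) ≤ L k i := by
  obtain ⟨h1, -, -, -, h5, h6, -⟩ := h
  induction k, hk using Int.leInduction with
  | base =>
    intro _ i hi hik
    rw [h1 i hi (by omega), show i + m - m = i by ring, muExt_of_mem hi (by omega)]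
  | succ k hk ih =>
    intro hkn i hi hik
    have a := h5 (k + 1) (by omega) hkn i hi (by omega)
    have a' := h6 (k + 1) (by omega) hkn (i + 1) (by omega) (by omega)
    have a'' := ih (by omega) (i + 1) (by omega) (by omega)
    rw [show k + 1 - 1 = k by ring] at a'
    rw [show i + 1 + k - m = i + (k + 1) - m by ring] at a''
    omega

/-- The potential `Σ_{i ≤ k} |λ_i - λ_{ki}| + Σ_{i > k} λ_i` of the row `k`, which
controls the tail sums of the weight. -/
def potential (n : ℤ) (lam : ℤ → ℤ) (L : ℤ → ℤ → ℤ) (k : ℤ) : ℤ :=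
  ∑ i ∈ Finset.Icc 1 k, |lam i - L k i| + ∑ i ∈ Finset.Icc (k + 1) n, lam i

lemma sum_Icc_one_eq_add {k : ℤ} (hk : 1 ≤ k) (f : ℤ → ℤ) :
    ∑ i ∈ Finset.Icc 1 k, f i = ∑ i ∈ Finset.Icc 1 (k - 1), f i + f k := by
  have hI : Finset.Icc 1 k = insert k (Finset.Icc 1 (k - 1)) := by
    ext x; simp only [Finset.mem_Icc, Finset.mem_insert]; omega
  rw [hI, Finset.sum_insert (by simp), add_comm]

lemma sum_Icc_eq_add {k n : ℤ} (hk : k ≤ n) (f : ℤ → ℤ) :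
    ∑ i ∈ Finset.Icc k n, f i = f k + ∑ i ∈ Finset.Icc (k + 1) n, f i := by
  have hI : Finset.Icc k n = insert k (Finset.Icc (k + 1) n) := by
    ext x; simp only [Finset.mem_Icc, Finset.mem_insert]; omega
  rw [hI, Finset.sum_insert (by simp)]

lemma potential_sub {k : ℤ} (hk : 1 ≤ k) (hkn : k ≤ n) :
    potential n lam L (k - 1) - potential n lam L k
      = ∑ i ∈ Finset.Icc 1 (k - 1), (|lam i - L (k - 1) i| - |lam i - L k i|)
        + (lam k - |lam k - L k k|) := by
  simp only [potential, sub_add_cancel, sum_Icc_eq_add hkn lam, Finset.sum_sub_distrib]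
  rw [sum_Icc_one_eq_add hk]
  ring

lemma wt_eq {k : ℤ} (hk : 1 ≤ k) :
    wt L lp k = ∑ i ∈ Finset.Icc 1 (k - 1), (2 * lp k i - L k i - L (k - 1) i)
      + (2 * lp k k - L k k) := by
  simp only [wt, Finset.sum_sub_distrib, ← Finset.mul_sum]
  rw [sum_Icc_one_eq_add hk (lp k), sum_Icc_one_eq_add hk (L k)]
  ring

lemma IsTrap.potential_sub_le_wt (h : IsTrap n m lam mu L lp) (hm : 0 ≤ m) {k : ℤ}
    (hk : m + 1 ≤ k) (hkn : k ≤ n) :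
    potential n lam L (k - 1) - potential n lam L k ≤ wt L lp k := by
  obtain ⟨-, -, -, h4, -, h6, -⟩ := h
  rw [potential_sub (by omega) hkn, wt_eq (by omega)]
  refine add_le_add (Finset.sum_le_sum fun i hi => ?_) ?_
  · rw [Finset.mem_Icc] at hi
    have := h4 k hk hkn i hi.1 (by omega)
    have := h6 k hk hkn i hi.1 hi.2
    simp only [abs_eq_max_neg]
    omega
  · have := h4 k hk hkn k (by omega) le_rfl
    simp only [abs_eq_max_neg]
    omega

lemma potential_top (h : ∀ i : ℤ, 1 ≤ i → i ≤ n → L n i = lam i) : potential n lam L n = 0 := by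
  have : ∀ i ∈ Finset.Icc 1 n, |lam i - L n i| = 0 := fun i hi => by
    rw [Finset.mem_Icc] at hi
    simp [h i hi.1 hi.2]
  simp [potential, Finset.sum_eq_zero this]

lemma sum_Icc_sub_pred {j : ℤ} (hj : j ≤ n) (f : ℤ → ℤ) :
    ∑ k ∈ Finset.Icc (j + 1) n, (f (k - 1) - f k) = f j - f n := by
  induction j, hj using Int.leInductionDown with
  | base => simp
  | pred j hj ih =>
    rw [sub_add_cancel, sum_Icc_eq_add hj, ih]
    ring

/-- The total weight has the parity of `|λ| + |μ|`. -/
lemma two_dvd_sum_wt_sub {L' lp' : ℤ → ℤ → ℤ} (hmn : m ≤ n)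
    (hbot : ∀ i : ℤ, 1 ≤ i → i ≤ m → L m i = L' m i)
    (htop : ∀ i : ℤ, 1 ≤ i → i ≤ n → L n i = L' n i) :
    (2 : ℤ) ∣ ∑ k ∈ Finset.Icc (m + 1) n, wt L lp k - ∑ k ∈ Finset.Icc (m + 1) n, wt L' lp' k := by
  have key : ∀ L lp : ℤ → ℤ → ℤ, ∑ k ∈ Finset.Icc (m + 1) n, wt L lp k
      = 2 * ∑ k ∈ Finset.Icc (m + 1) n,
          ((∑ i ∈ Finset.Icc 1 k, lp k i) - ∑ i ∈ Finset.Icc 1 k, L k i)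
        - (∑ i ∈ Finset.Icc 1 m, L m i - ∑ i ∈ Finset.Icc 1 n, L n i) := by
    intro L lp
    rw [← sum_Icc_sub_pred hmn (fun k => ∑ i ∈ Finset.Icc 1 k, L k i), Finset.mul_sum,
      ← Finset.sum_sub_distrib]
    refine Finset.sum_congr rfl fun k _ => ?_
    simp only [wt]
    ring
  have eb : ∑ i ∈ Finset.Icc 1 m, L m i = ∑ i ∈ Finset.Icc 1 m, L' m i :=
    Finset.sum_congr rfl fun i hi => hbot i (Finset.mem_Icc.1 hi).1 (Finset.mem_Icc.1 hi).2
  have et : ∑ i ∈ Finset.Icc 1 n, L n i = ∑ i ∈ Finset.Icc 1 n, L' n i :=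
    Finset.sum_congr rfl fun i hi => htop i (Finset.mem_Icc.1 hi).1 (Finset.mem_Icc.1 hi).2
  rw [key L lp, key L' lp', eb, et]
  omega

end Pattern

end TY16

/-- **Statement 16** (Proposition 4.4): assuming at least one trapezium
pattern with top row `λ` and bottom row `μ` exists, the array `Λ₀` given by
the `mid`-formulas is a trapezium pattern, and its weight dominates the weight
of every trapezium pattern with top row `λ` and bottom row `μ`; in
particular the set of weights of such patterns has the unique maximal element
`w(Λ₀)`. -/
theorem statement_16
    (n m : ℤ) (hm : 0 ≤ m) (hmn : m < n)
    (lam mu : ℤ → ℤ)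
    (hlam0 : lam 1 ≤ 0) (hlam : ∀ i : ℤ, 1 ≤ i → i < n → lam (i+1) ≤ lam i)
    (hmu0 : mu 1 ≤ 0) (hmu : ∀ i : ℤ, 1 ≤ i → i < m → mu (i+1) ≤ mu i)
    (hex : ∃ L lp : ℤ → ℤ → ℤ, IsTrap n m lam mu L lp) :
    IsTrap n m lam mu (L0 n m lam mu) (lp0 m lam mu)
      ∧ ∀ L lp : ℤ → ℤ → ℤ, IsTrap n m lam mu L lp →
          wle m n (wt L lp) (wt (L0 n m lam mu) (lp0 m lam mu)) := by
  set b : ℤ := min (lam n) (muV mu m) with hb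
  set M : ℤ → ℤ := muExt m b mu with hM
  have hanti : Antitone M := muExt_antitone hm hmu0 hmu (min_le_right _ _)
  have hbl : ∀ i, 1 ≤ i → i ≤ n → b ≤ lam i := by
    intro i hi hin
    refine (min_le_left _ _).trans ?_
    induction i, hin using Int.leInductionDown with
    | base => exact le_rfl
    | pred i hin ih =>
      have := hlam (i - 1) hi (by omega)
      rw [sub_add_cancel] at this
      exact (ih (by omega)).trans this
  have hMbig : ∀ j, m < j → M j = b := fun j hj => by simp [hM, muExt, hj]
  have hlo : ∀ L lp, IsTrap n m lam mu L lp → ∀ k i, m ≤ k → k ≤ n → 1 ≤ i → i ≤ k →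
      M (i + k - m) ≤ lam i ∨ M (i + k - m) ≤ L k i := by
    intro L lp h k i hk hkn hi hik
    by_cases hc : m < i + k - m
    · exact .inl (by rw [hMbig _ hc]; exact hbl i hi (by omega))
    · exact .inr (h.muExt_le b k hk hkn i hi (by omega))
  have hlp : ∀ k i, m + 1 ≤ k → k ≤ n → 1 ≤ i → i ≤ k →
      lp0 m lam mu k i = max (M (i + k - m - 1)) (min (lam i) (M (i + m - k))) :=
    fun k i hk hkn hi hik =>
      mid3_eq_clamp hanti (hbl i hi (by omega)) (by omega) (by omega)
  have hL : ∀ k i, m ≤ k → k ≤ n → 1 ≤ i → i ≤ k →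
      L0 n m lam mu k i = max (M (i + k - m)) (min (lam i) (M (i + m - k))) := by
    intro k i hk hkn hi hik
    unfold L0
    split_ifs with h1 h2
    · subst h1
      obtain ⟨L, lp, h⟩ := hex
      have a := hlo L lp h k i hk le_rfl hi hik
      have a' : L k i ≤ M (i + m - k) := h.le_muExt hm b k hk le_rfl i hi hik
      rw [h.2.1 i hi hik] at a a'
      omega
    · subst h2
      have e : M i = mu i := muExt_of_mem hi hik
      rw [show i + k - k = i by ring, e]
      omega
    · exact mid3_eq_clamp hanti (hbl i hi (by omega)) (by omega) (by omega)
  have htrap : IsTrap n m lam mu (L0 n m lam mu) (lp0 m lam mu) := by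
    refine ⟨?_, ?_, ?_, ?_, ?_, ?_, ?_⟩
    · intro i hi him
      simp [L0, hmn.ne]
    · intro i hi hin
      simp [L0]
    · intro k hk hkn
      rw [hlp k 1 hk hkn le_rfl (by omega)]
      have e : M (1 + m - k) = 0 := muExt_of_nonpos hm (by omega)
      have := hanti (show 1 + m - k ≤ 1 + k - m - 1 by omega)
      omega
    · intro k hk hkn i hi hik
      rw [hlp k i hk hkn hi hik, hL k i (by omega) hkn hi hik]
      have := hanti (show i + k - m - 1 ≤ i + k - m by omega)
      omega
    · intro k hk hkn i hi hik
      rw [hlp k (i + 1) hk hkn (by omega) (by omega), hL k i (by omega) hkn hi (by omega)]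
      have := hanti (show i + m - k ≤ i + 1 + m - k by omega)
      have := hlam i hi (by omega)
      rw [show i + 1 + k - m - 1 = i + k - m by ring]
      omega
    · intro k hk hkn i hi hik
      rw [hlp k i hk hkn hi (by omega), hL (k - 1) i (by omega) (by omega) hi hik]
      have := hanti (show i + m - k ≤ i + m - (k - 1) by omega)
      rw [show i + (k - 1) - m = i + k - m - 1 by ring]
      omega
    · intro k hk hkn i hi hik
      rw [hlp k (i + 1) hk hkn (by omega) (by omega), hL (k - 1) i (by omega) (by omega) hi hik]
      have := hanti (show i + (k - 1) - m ≤ i + 1 + k - m - 1 by omega)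
      have := hlam i hi (by omega)
      rw [show i + m - (k - 1) = i + 1 + m - k by ring]
      omega
  have hwt0 : ∀ k, m + 1 ≤ k → k ≤ n → wt (L0 n m lam mu) (lp0 m lam mu) k
      = potential n lam (L0 n m lam mu) (k - 1) - potential n lam (L0 n m lam mu) k := by
    intro k hk hkn
    rw [potential_sub (by omega) hkn, wt_eq (by omega)]
    congr 1
    · refine Finset.sum_congr rfl fun i hi => ?_
      rw [Finset.mem_Icc] at hi
      rw [hlp k i hk hkn hi.1 (by omega), hL k i (by omega) hkn hi.1 (by omega),
        hL (k - 1) i (by omega) (by omega) hi.1 hi.2,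
        show i + (k - 1) - m = i + k - m - 1 by ring]
      have := hanti (show i + m - k ≤ i + m - (k - 1) by omega)
      have := hanti (show i + k - m - 1 ≤ i + k - m by omega)
      have := hanti (show i + m - (k - 1) ≤ i + k - m - 1 by omega)
      simp only [abs_eq_max_neg]
      omega
    · rw [hlp k k hk hkn (by omega) le_rfl, hL k k (by omega) hkn (by omega) le_rfl,
        hMbig (k + k - m - 1) (by omega), hMbig (k + k - m) (by omega)]
      have := hbl k (by omega) hkn
      have : b ≤ M (k + m - k) := by
        rw [← hMbig (k + k - m) (by omega)]
        exact hanti (by omega)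
      simp only [abs_eq_max_neg]
      omega
  refine ⟨htrap, fun L lp h => wle_of_tail_sums hmn (fun j hj hjn => ?_)
    (two_dvd_sum_wt_sub hmn.le ?_ ?_)⟩
  · calc ∑ k ∈ Finset.Icc (j + 1) n, wt (L0 n m lam mu) (lp0 m lam mu) k
        = potential n lam (L0 n m lam mu) j := by
          rw [← sub_zero (potential n lam (L0 n m lam mu) j), ← potential_top htrap.2.1,
            ← sum_Icc_sub_pred hjn]
          refine Finset.sum_congr rfl fun k hk => ?_
          rw [Finset.mem_Icc] at hk
          exact hwt0 k (by omega) hk.2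
      _ ≤ potential n lam L j := by
          refine add_le_add (Finset.sum_le_sum fun i hi => ?_) le_rfl
          rw [Finset.mem_Icc] at hi
          rw [hL j i hj hjn hi.1 hi.2]
          have a := hlo L lp h j i hj hjn hi.1 hi.2
          have a' : L j i ≤ M (i + m - j) := h.le_muExt hm b j hj hjn i hi.1 hi.2
          have := hanti (show i + m - j ≤ i + j - m by omega)
          simp only [abs_eq_max_neg]
          omega
      _ ≤ ∑ k ∈ Finset.Icc (j + 1) n, wt L lp k := by
          rw [← sub_zero (potential n lam L j), ← potential_top h.2.1, ← sum_Icc_sub_pred hjn]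
          refine Finset.sum_le_sum fun k hk => ?_
          rw [Finset.mem_Icc] at hk
          exact h.potential_sub_le_wt hm (by omega) hk.2
  · intro i hi him
    rw [h.1 i hi him, htrap.1 i hi him]
  · intro i hi hin
    rw [h.2.1 i hi hin, htrap.2.1 i hi hin]
end
end

section
/- For each k=1,…,n−m the set Γ(μ) ∩ Γ(λ)^{(k−1)} is finite; define P_k(u) = Π over cells α ∈ Γ(μ)∩Γ(λ)^{(k−1)} of (u + c(α) + 1/2). Then, as identities of rational functions in u: μ_{m+1}(−u)/μ_{m+1}(u) = P_1(u+1)/P_1(u), and μ_{k−1}(u)/μ_k(u) = P_{k−m}(u+1)/P_{k−m}(u) for k=m+2,…,n; moreover P_1(u)=P_1(−u+1). (Thus P_1(u),…,P_{n−m}(u) are the Drinfeld polynomials of the skew representation V(λ)^+_μ of Y(sp_{N−M}), whose highest weight components are the μ_k(u).) -/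
/-! The Drinfeld polynomials of the skew representations of the twisted
Yangian `Y(sp_{2n-2m})` (Molev, "Skew representations of twisted Yangians",
Theorem 4.8), as identities of rational functions in `RatFunc ℂ`. -/

noncomputable section

open scoped BigOperators

attribute [local instance] Classical.propDecidable

namespace TY18

/-- `μ_j` with the convention `μ_j = 0` for `j ≤ 0`. -/
def muV (mu : ℤ → ℤ) (j : ℤ) : ℤ := if j ≤ 0 then 0 else mu j

/-- The rational function `(t+a)/(t+b)`. -/
def linFracR (a b : ℂ) (t : RatFunc ℂ) : RatFunc ℂ :=
  (t + RatFunc.C a) / (t + RatFunc.C b)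

/-- `ν(u) = Π_{i=1}^m (u+μ_i-i+1/2)(u-μ_i+i+1/2)/((u-i+1/2)(u+i+1/2))` as a
rational function of `t`. -/
def nuR (m : ℤ) (mu : ℤ → ℤ) (t : RatFunc ℂ) : RatFunc ℂ :=
  ∏ i ∈ Finset.Icc (1 : ℤ) m,
    (linFracR (((mu i - i : ℤ) : ℂ) + 1/2) (((-i : ℤ) : ℂ) + 1/2) t *
      linFracR (((i - mu i : ℤ) : ℂ) + 1/2) (((i : ℤ) : ℂ) + 1/2) t)

/-- The `k`-th highest-weight component `μ_k` of the skew representation as a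
rational function of `t` (`m+1 ≤ k ≤ n`), with the conventions `μ_j = 0` for
`j ≤ 0` and `μ_j = -∞` for `j > m`. -/
def muR (m : ℤ) (lam mu : ℤ → ℤ) (k : ℤ) (t : RatFunc ℂ) : RatFunc ℂ :=
  nuR m mu t *
  (∏ i ∈ (Finset.Icc (1 : ℤ) (k-1)).filter
      (fun i => i+k-m-1 ≤ m ∧ lam i < muV mu (i+k-m-1)),
    linFracR
      (((k - m + i -
          (if m < i+k-m then lam i else max (lam i) (muV mu (i+k-m))) : ℤ) : ℂ)
        - 1/2)
      (((k - m + i - muV mu (i+k-m-1) : ℤ) : ℂ) - 1/2) t) *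
  (∏ i ∈ (Finset.Icc (1 : ℤ) (k-1)).filter
      (fun i => muV mu (i+m-k+1) < lam i),
    linFracR
      (((min (lam i) (muV mu (i+m-k)) + k - m - i : ℤ) : ℂ) - 1/2)
      (((muV mu (i+m-k+1) + k - m - i : ℤ) : ℂ) - 1/2) t) *
  linFracR (((min (lam k) (muV mu m) - m : ℤ) : ℂ) - 1/2) (((-m : ℤ) : ℂ) - 1/2) t

/-- `λ_i` extended by `λ_{-i} = -λ_i` and `λ_0 = 0`. -/
def lamFull (lam : ℤ → ℤ) (i : ℤ) : ℤ :=
  if 1 ≤ i then lam i else if i = 0 then 0 else -lam (-i)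

/-- The diagram `Γ(λ) = {(i,j) : -n ≤ i ≤ n+1, λ_i ≤ j < λ_{i-1}}`, with
`λ_k = -∞` and `λ_{-k} = +∞` for `k > n`. -/
def Gamma (n : ℤ) (lam : ℤ → ℤ) : Set (ℤ × ℤ) :=
  {p | -n ≤ p.1 ∧ p.1 ≤ n+1 ∧ (p.1 ≤ n → lamFull lam p.1 ≤ p.2)
      ∧ (-n+1 ≤ p.1 → p.2 < lamFull lam (p.1-1))}

/-- The set of cells of `Γ(μ) ∩ Γ(λ)^{(k-1)}`, where `Γ(λ)^{(p)}` is `Γ(λ)`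
lifted `p` units up. -/
def cells (n m : ℤ) (lam mu : ℤ → ℤ) (k : ℤ) : Set (ℤ × ℤ) :=
  {q | q ∈ Gamma m mu ∧ (q.1 + (k-1), q.2) ∈ Gamma n lam}

/-- `P_k` evaluated at `t`: the product of `t + c(α) + 1/2` over the cells
`α` of `Γ(μ) ∩ Γ(λ)^{(k-1)}` (a finite product when the cell set is finite,
by convention `1` otherwise). -/
def Pfun (n m : ℤ) (lam mu : ℤ → ℤ) (k : ℤ) (t : RatFunc ℂ) : RatFunc ℂ :=
  ∏ᶠ q ∈ cells n m lam mu k, (t + RatFunc.C (((q.2 - q.1 : ℤ) : ℂ) + 1/2))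

end TY18

open TY18

namespace TY18

/-- The linear factor `t + a + 1/2`. -/
def halfFactor (t : RatFunc ℂ) (a : ℤ) : RatFunc ℂ := t + RatFunc.C ((a : ℂ) + 1/2)

theorem halfFactor_X_ne_zero (a : ℤ) : halfFactor RatFunc.X a ≠ 0 := by
  intro h
  have h1 : algebraMap (Polynomial ℂ) (RatFunc ℂ)
      (Polynomial.X + Polynomial.C ((a : ℂ) + 1/2)) = 0 := by
    rw [map_add, RatFunc.algebraMap_X, RatFunc.algebraMap_C]
    exact h
  exact Polynomial.X_add_C_ne_zero _
    ((map_eq_zero_iff _ (RatFunc.algebraMap_injective ℂ)).mp h1)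

theorem halfFactor_neg_X (a : ℤ) :
    halfFactor (-RatFunc.X) a = -halfFactor RatFunc.X (-a - 1) := by
  have h : (((-a - 1 : ℤ) : ℂ) + 1/2) = -((a : ℂ) + 1/2) := by push_cast; ring
  rw [halfFactor, halfFactor, h, map_neg]
  ring

theorem halfFactor_neg_X_ne_zero (a : ℤ) : halfFactor (-RatFunc.X) a ≠ 0 := by
  rw [halfFactor_neg_X]
  exact neg_ne_zero.mpr (halfFactor_X_ne_zero _)

theorem halfFactor_add_one (t : RatFunc ℂ) (a : ℤ) :
    halfFactor (t + 1) a = halfFactor t (a + 1) := by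
  have h : (((a + 1 : ℤ) : ℂ) + 1/2) = 1 + ((a : ℂ) + 1/2) := by push_cast; ring
  rw [halfFactor, halfFactor, h, map_add RatFunc.C 1, map_one]
  ring

theorem linFracR_add_half (a b : ℤ) (t : RatFunc ℂ) :
    linFracR ((a : ℂ) + 1/2) ((b : ℂ) + 1/2) t = halfFactor t a / halfFactor t b := rfl

theorem linFracR_sub_half (a b : ℤ) (t : RatFunc ℂ) :
    linFracR ((a : ℂ) - 1/2) ((b : ℂ) - 1/2) t
      = halfFactor t (a - 1) / halfFactor t (b - 1) := by
  have h (c : ℤ) : (c : ℂ) - 1/2 = ((c - 1 : ℤ) : ℂ) + 1/2 := by push_cast; ring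
  rw [h, h, linFracR_add_half]

theorem prod_Ico_div_telescope {K : Type*} [Field K] (g : ℤ → K) (hg : ∀ j, g j ≠ 0)
    {a b : ℤ} (hab : a ≤ b) : ∏ j ∈ Finset.Ico a b, g (j + 1) / g j = g b / g a := by
  induction b, hab using Int.leInduction with
  | base => simp [hg]
  | succ b hab ih =>
    rw [← Finset.insert_Ico_right_eq_Ico_add_one hab, Finset.prod_insert (by simp), ih]
    have := hg b
    have := hg a
    field_simp

theorem lamFull_neg (f : ℤ → ℤ) (i : ℤ) : lamFull f (-i) = -lamFull f i := by
  unfold lamFull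
  split_ifs <;> first | omega | simp

theorem lamFull_of_pos (f : ℤ → ℤ) {i : ℤ} (hi : 1 ≤ i) : lamFull f i = f i := if_pos hi

theorem lamFull_zero (f : ℤ → ℤ) : lamFull f 0 = 0 := by simp [lamFull]

theorem lamFull_anti {f : ℤ → ℤ} {N : ℤ} (h0 : f 1 ≤ 0)
    (h : ∀ i, 1 ≤ i → i < N → f (i + 1) ≤ f i) {a b : ℤ} (ha : -N ≤ a) (hab : a ≤ b)
    (hb : b ≤ N) : lamFull f b ≤ lamFull f a := by
  induction b, hab using Int.leInduction with
  | base => rfl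
  | succ b hab ih =>
    refine le_trans ?_ (ih (by omega))
    rcases lt_trichotomy b 0 with hb0 | rfl | hb0
    · obtain ⟨c, rfl⟩ : ∃ c, b = -(c + 1) := ⟨-b - 1, by omega⟩
      rw [show -(c + 1) + 1 = -c by ring, lamFull_neg, lamFull_neg, lamFull_of_pos f (show 1 ≤ c + 1 by omega)]
      rcases eq_or_lt_of_le (show 0 ≤ c by omega) with rfl | hc
      · rw [lamFull_zero]
        simpa using h0
      · rw [lamFull_of_pos f (by omega)]
        exact neg_le_neg (h c (by omega) (by omega))
    · rw [lamFull_zero, lamFull_of_pos f (by omega)]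
      simpa using h0
    · rw [lamFull_of_pos f (by omega), lamFull_of_pos f (by omega)]
      exact h b (by omega) (by omega)

/-- The sequence `μ_1, …, μ_m` continued by the constant value `b`. -/
def extendBy (m b : ℤ) (mu : ℤ → ℤ) (i : ℤ) : ℤ := if i ≤ m then mu i else b

/-- The value `L (r+p)` clamped to the interval from `M r` to `M (r-1)`. -/
def clampRow (L M : ℤ → ℤ) (p r : ℤ) : ℤ := max (M r) (min (L (r + p)) (M (r - 1)))

theorem prod_row_telescope {K : Type*} [Field K] (g : ℤ → K) (hg : ∀ j, g j ≠ 0)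
    (L M : ℤ → ℤ) (p r : ℤ) (hL : L (r + p) ≤ L (r + p - 1)) (hM : M r ≤ M (r - 1)) :
    ∏ j ∈ Finset.Ico (max (M r) (L (r + p))) (min (M (r - 1)) (L (r + p - 1))),
        g (j + 1) / g j
      = g (clampRow L M (p - 1) r) / g (clampRow L M p r) := by
  have hp : r + (p - 1) = r + p - 1 := by ring
  unfold clampRow
  rw [hp]
  rcases le_total (max (M r) (L (r + p))) (min (M (r - 1)) (L (r + p - 1))) with h | h
  · rw [prod_Ico_div_telescope g hg h]
    congr 2 <;> omega
  · rw [Finset.Ico_eq_empty_of_le h, Finset.prod_empty]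
    rw [show max (M r) (min (L (r + p - 1)) (M (r - 1)))
      = max (M r) (min (L (r + p)) (M (r - 1))) by omega, div_self (hg _)]

theorem mem_cells_iff {n m : ℤ} (hm : 0 ≤ m) (lam mu : ℤ → ℤ)
    (hL : ∀ a b : ℤ, -n ≤ a → a ≤ b → b ≤ n → lamFull lam b ≤ lamFull lam a)
    {k : ℤ} (hk1 : 1 ≤ k) (hk : k ≤ n - m) (q : ℤ × ℤ) :
    q ∈ cells n m lam mu k ↔ q.1 ∈ Finset.Icc (-m) (m + 1) ∧
      q.2 ∈ Finset.Ico
        (max (lamFull (extendBy m (lam n) mu) q.1) (lamFull lam (q.1 + (k - 1))))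
        (min (lamFull (extendBy m (lam n) mu) (q.1 - 1)) (lamFull lam (q.1 + (k - 1) - 1))) := by
  obtain ⟨r, j⟩ := q
  simp only [cells, Gamma, Set.mem_ofPred_eq, Finset.mem_Icc, Finset.mem_Ico, max_le_iff,
    lt_min_iff]
  have hext (a : ℤ) (h1 : -m ≤ a) (h2 : a ≤ m) :
      lamFull (extendBy m (lam n) mu) a = lamFull mu a := by
    unfold lamFull extendBy
    split_ifs <;> first | rfl | omega
  have htop : lamFull (extendBy m (lam n) mu) (m + 1) = lamFull lam n := by
    rw [lamFull_of_pos _ (by omega), lamFull_of_pos _ (by omega), extendBy, if_neg (by omega)]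
  have hbot : lamFull (extendBy m (lam n) mu) (-m - 1) = lamFull lam (-n) := by
    rw [show -m - 1 = -(m + 1) by ring, lamFull_neg, htop, lamFull_neg]
  constructor
  · rintro ⟨⟨h1, h2, h3, h4⟩, h5, h6, h7, h8⟩
    have h7 := h7 (by omega)
    have h8 := h8 (by omega)
    refine ⟨⟨h1, h2⟩, ⟨?_, h7⟩, ?_, h8⟩
    · rcases eq_or_lt_of_le h2 with rfl | h2
      · rw [htop]
        exact (hL _ _ (by omega) (by omega) le_rfl).trans h7
      · rw [hext _ h1 (by omega)]
        exact h3 (by omega)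
    · rcases eq_or_lt_of_le h1 with rfl | h1
      · rw [hbot]
        exact h8.trans_le (hL _ _ le_rfl (by omega) (by omega))
      · rw [hext _ (by omega) (by omega)]
        exact h4 (by omega)
  · rintro ⟨⟨h1, h2⟩, ⟨h3, h4⟩, h5, h6⟩
    refine ⟨⟨h1, h2, fun h => ?_, fun h => ?_⟩, by omega, by omega, fun _ => h4, fun _ => h6⟩
    · rwa [hext _ h1 h] at h3
    · rwa [hext _ (by omega) (by omega)] at h5

theorem Pfun_eq_prod {n m : ℤ} {lam mu : ℤ → ℤ} {k : ℤ} (hfin : (cells n m lam mu k).Finite)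
    (t : RatFunc ℂ) :
    Pfun n m lam mu k t = ∏ q ∈ hfin.toFinset, halfFactor t (q.2 - q.1) := by
  unfold Pfun halfFactor
  rw [finprod_mem_eq_finite_toFinset_prod _ hfin]

theorem Pfun_ratio {n m : ℤ} {lam mu : ℤ → ℤ} {k : ℤ} (hfin : (cells n m lam mu k).Finite)
    (L M : ℤ → ℤ) (hcells : ∀ q : ℤ × ℤ, q ∈ cells n m lam mu k ↔
      q.1 ∈ Finset.Icc (-m) (m + 1) ∧
      q.2 ∈ Finset.Ico (max (M q.1) (L (q.1 + (k - 1))))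
        (min (M (q.1 - 1)) (L (q.1 + (k - 1) - 1))))
    (hL : ∀ r, -m ≤ r → r ≤ m + 1 → L (r + (k - 1)) ≤ L (r + (k - 1) - 1))
    (hM : ∀ r, -m ≤ r → r ≤ m + 1 → M r ≤ M (r - 1)) :
    Pfun n m lam mu k (RatFunc.X + 1) / Pfun n m lam mu k RatFunc.X
      = ∏ r ∈ Finset.Icc (-m) (m + 1), halfFactor RatFunc.X (clampRow L M (k - 1 - 1) r - r) /
          halfFactor RatFunc.X (clampRow L M (k - 1) r - r) := by
  rw [Pfun_eq_prod hfin, Pfun_eq_prod hfin, ← Finset.prod_div_distrib,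
    Finset.prod_finset_product _ (Finset.Icc (-m) (m + 1))
      (fun r => Finset.Ico (max (M r) (L (r + (k - 1))))
        (min (M (r - 1)) (L (r + (k - 1) - 1)))) (by simpa using hcells)]
  refine Finset.prod_congr rfl fun r hr => ?_
  rw [Finset.mem_Icc] at hr
  rw [← prod_row_telescope (fun j => halfFactor RatFunc.X (j - r))
    (fun _ => halfFactor_X_ne_zero _) L M (k - 1) r (hL r hr.1 hr.2) (hM r hr.1 hr.2)]
  refine Finset.prod_congr rfl fun j _ => ?_
  rw [halfFactor_add_one, show j - r + 1 = j + 1 - r by ring]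

theorem prod_Icc_symm {A : Type*} [CommMonoid A] (f : ℤ → A) {m : ℤ} (hm : 0 ≤ m) :
    ∏ r ∈ Finset.Icc (-m) (m + 1), f r
      = (∏ r ∈ Finset.Icc (-m) 0, f r) * (∏ r ∈ Finset.Icc 1 m, f r) * f (m + 1) := by
  have h1 : Finset.Icc (-m) (m + 1) = insert (m + 1) (Finset.Icc (-m) 0 ∪ Finset.Icc 1 m) := by
    ext x
    simp only [Finset.mem_Icc, Finset.mem_insert, Finset.mem_union]
    omega
  rw [h1, Finset.prod_insert, Finset.prod_union, mul_comm]
  · rw [Finset.disjoint_left]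
    intro x
    simp only [Finset.mem_Icc]
    omega
  · simp only [Finset.mem_Icc, Finset.mem_union]
    omega

theorem nuR_eq_prod {m : ℤ} (mu M : ℤ → ℤ) (t : RatFunc ℂ)
    (ht : ∀ a, halfFactor t a ≠ 0) (hodd : ∀ r, M (-r) = -M r)
    (hM : ∀ i, 1 ≤ i → i ≤ m → M i = mu i) :
    nuR m mu t = (∏ r ∈ Finset.Icc (-m) 0, halfFactor t (M r - r) / halfFactor t (-r)) *
      ∏ r ∈ Finset.Icc 1 m, halfFactor t (M r - r) / halfFactor t (-r) := by
  have h0 : M 0 = 0 := by have := hodd 0; simp at this; omega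
  unfold nuR
  rw [Finset.prod_mul_distrib, mul_comm]
  congr 1
  · refine Finset.prod_of_injOn (fun i => -i) (fun a _ b _ h => neg_injective h) ?_ ?_ ?_
    · intro i hi
      simp only [Finset.coe_Icc, Set.mem_Icc] at hi ⊢
      omega
    · intro r hr hr'
      simp only [Finset.coe_Icc, Set.mem_image, Set.mem_Icc, not_exists, not_and,
        Finset.mem_Icc] at hr hr'
      have : r = 0 := by
        by_contra h
        exact hr' (-r) (by omega) (by omega)
      subst this
      rw [h0, sub_zero, neg_zero, div_self (ht _)]
    · intro i hi
      rw [Finset.mem_Icc] at hi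
      rw [linFracR_add_half, hodd, hM i hi.1 hi.2]
      congr 2 <;> ring
  · refine Finset.prod_congr rfl fun i hi => ?_
    rw [Finset.mem_Icc] at hi
    rw [linFracR_add_half, hM i hi.1 hi.2]

theorem muR_eq_prod {n m : ℤ} (hm : 0 ≤ m) (lam mu : ℤ → ℤ)
    (M : ℤ → ℤ) (t : RatFunc ℂ) (ht : ∀ a, halfFactor t a ≠ 0) (hodd : ∀ r, M (-r) = -M r)
    (hM : ∀ i, 1 ≤ i → i ≤ m → M i = mu i) (htop : M (m + 1) = lam n)
    (hanti : ∀ a b : ℤ, -(m + 1) ≤ a → a ≤ b → b ≤ m + 1 → M b ≤ M a)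
    (hL : ∀ a b : ℤ, -n ≤ a → a ≤ b → b ≤ n → lamFull lam b ≤ lamFull lam a)
    {k : ℤ} (hk1 : m + 1 ≤ k) (hk : k ≤ n) :
    muR m lam mu k t = ∏ r ∈ Finset.Icc (-m) (m + 1),
      halfFactor t (clampRow (lamFull lam) M (k - m - 1) r - r) / halfFactor t (-r) := by
  have h0 : M 0 = 0 := by have := hodd 0; simp at this; omega
  have hpos (i : ℤ) (h : 1 ≤ i) : lamFull lam i = lam i := lamFull_of_pos lam h
  have hneg (i : ℤ) (h : 1 ≤ i) : lamFull lam (-i) = -lam i := by rw [lamFull_neg, hpos i h]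
  have hlam0 (i : ℤ) (h : 0 ≤ i) (h' : i ≤ n) : lamFull lam i ≤ 0 := by
    have := hL 0 i (by omega) h h'
    rwa [lamFull_zero] at this
  have hMV (i : ℤ) (h : 0 ≤ i) (h' : i ≤ m) : muV mu i = M i := by
    unfold muV
    split_ifs with hi
    · rw [show i = 0 by omega, h0]
    · rw [hM i (by omega) h']
  have hMnonneg (r : ℤ) (h : r ≤ 0) (h' : -(m + 1) ≤ r) : 0 ≤ M r := by
    have := hanti r 0 h' h (by omega)
    omega
  set T : ℤ → RatFunc ℂ := fun r =>
    halfFactor t (clampRow (lamFull lam) M (k - m - 1) r - r) / halfFactor t (M r - r) with hT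
  have hT1 (r : ℤ) (h : clampRow (lamFull lam) M (k - m - 1) r = M r) : T r = 1 := by
    simp only [hT, h]
    exact div_self (ht _)
  have first : (∏ i ∈ (Finset.Icc (1 : ℤ) (k-1)).filter
      (fun i => i+k-m-1 ≤ m ∧ lam i < muV mu (i+k-m-1)),
    linFracR
      (((k - m + i -
          (if m < i+k-m then lam i else max (lam i) (muV mu (i+k-m))) : ℤ) : ℂ)
        - 1/2)
      (((k - m + i - muV mu (i+k-m-1) : ℤ) : ℂ) - 1/2) t) = ∏ r ∈ Finset.Icc (-m) 0, T r := by
    refine Finset.prod_of_injOn (fun i => -(i + k - m - 1)) ?_ ?_ ?_ ?_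
    · intro a _ b _ h
      simp only at h
      omega
    · intro i hi
      simp only [Finset.coe_filter, Finset.coe_Icc, Finset.mem_Icc, Set.mem_Icc,
        Set.mem_ofPred_eq] at hi ⊢
      omega
    · intro r hr hr'
      apply hT1
      simp only [Finset.coe_filter, Set.mem_image, not_exists, not_and, Finset.mem_Icc,
        Set.mem_ofPred_eq] at hr hr'
      have hr' := hr' (-r - (k - m - 1))
      have hMr := hanti (r - 1) r (by omega) (by omega) (by omega)
      have hMr0 := hMnonneg r hr.2 (by omega)
      unfold clampRow
      rcases le_or_gt 0 (r + (k - m - 1)) with h | h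
      · have := hlam0 _ h (by omega)
        omega
      · have e1 := hneg (-r - (k - m - 1)) (by omega)
        have e2 := hMV (-r) (by omega) (by omega)
        rw [hodd] at e2
        rw [show -(-r - (k - m - 1)) = r + (k - m - 1) by ring] at e1
        rw [show -r - (k - m - 1) + k - m - 1 = -r by ring, e2] at hr'
        omega
    · intro i hi
      simp only [Finset.mem_filter, Finset.mem_Icc] at hi
      obtain ⟨⟨hi1, hi2⟩, hi3, hi4⟩ := hi
      rw [hMV _ (by omega) hi3] at hi4 ⊢
      have e1 := hneg i hi1
      have e2 := hodd (i + k - m - 1)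
      have e3 := hodd (i + k - m)
      have hmono := hanti (i + k - m - 1) (i + k - m) (by omega) (by omega) (by omega)
      rw [linFracR_sub_half]
      simp only [hT, clampRow]
      rw [show -(i + k - m - 1) + (k - m - 1) = -i by ring,
        show -(i + k - m - 1) - 1 = -(i + k - m) by ring]
      split_ifs with hcase
      · have hmm : i + k - m = m + 1 := by omega
        have e4 : M (i + k - m) = lam n := by rw [hmm, htop]
        have hl := hL i n (by omega) (by omega) le_rfl
        rw [hpos i hi1, hpos n (by omega)] at hl
        congr 2 <;> omega
      · rw [hMV (i + k - m) (by omega) (by omega)]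
        congr 2 <;> omega
  have second : (∏ i ∈ (Finset.Icc (1 : ℤ) (k-1)).filter
      (fun i => muV mu (i+m-k+1) < lam i),
    linFracR
      (((min (lam i) (muV mu (i+m-k)) + k - m - i : ℤ) : ℂ) - 1/2)
      (((muV mu (i+m-k+1) + k - m - i : ℤ) : ℂ) - 1/2) t) = ∏ r ∈ Finset.Icc 1 m, T r := by
    have key (i : ℤ) (h1 : 1 ≤ i) (h2 : i ≤ k - 1) (h : muV mu (i+m-k+1) < lam i) :
        1 ≤ i + m - k + 1 := by
      by_contra hc
      have := hlam0 i (by omega) (by omega)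
      rw [hpos i h1] at this
      rw [muV, if_pos (by omega)] at h
      omega
    refine Finset.prod_of_injOn (fun i => i + m - k + 1) ?_ ?_ ?_ ?_
    · intro a _ b _ h
      simp only at h
      omega
    · intro i hi
      simp only [Finset.coe_filter, Finset.coe_Icc, Finset.mem_Icc, Set.mem_Icc,
        Set.mem_ofPred_eq] at hi ⊢
      have := key i hi.1.1 hi.1.2 hi.2
      omega
    · intro r hr hr'
      apply hT1
      simp only [Finset.coe_filter, Set.mem_image, not_exists, not_and, Finset.mem_Icc,
        Set.mem_ofPred_eq] at hr hr'
      have hr' := hr' (r + (k - m - 1))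
      have hMr := hanti (r - 1) r (by omega) (by omega) (by omega)
      have e1 := hpos (r + (k - m - 1)) (by omega)
      have e2 := hMV r (by omega) (by omega)
      rw [show r + (k - m - 1) + m - k + 1 = r by ring, e2] at hr'
      unfold clampRow
      omega
    · intro i hi
      simp only [Finset.mem_filter, Finset.mem_Icc] at hi
      obtain ⟨⟨hi1, hi2⟩, hi3⟩ := hi
      have hr := key i hi1 hi2 hi3
      rw [hMV _ (by omega) (by omega)] at hi3 ⊢
      rw [hMV _ (by omega) (by omega)]
      have e1 := hpos i hi1
      have hmono := hanti (i + m - k) (i + m - k + 1) (by omega) (by omega) (by omega)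
      rw [linFracR_sub_half]
      simp only [hT, clampRow]
      rw [show i + m - k + 1 + (k - m - 1) = i by ring,
        show i + m - k + 1 - 1 = i + m - k by ring]
      congr 2 <;> omega
  have last : linFracR (((min (lam k) (muV mu m) - m : ℤ) : ℂ) - 1/2)
      (((-m : ℤ) : ℂ) - 1/2) t
      = halfFactor t (clampRow (lamFull lam) M (k - m - 1) (m + 1) - (m + 1)) /
        halfFactor t (-(m + 1)) := by
    rw [linFracR_sub_half, hMV m hm le_rfl, clampRow, htop,
      show m + 1 + (k - m - 1) = k by ring, hpos k (by omega), show m + 1 - 1 = m by ring]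
    have h1 := hL k n (by omega) hk le_rfl
    rw [hpos k (by omega), hpos n (by omega)] at h1
    have h2 := hanti m (m + 1) (by omega) (by omega) le_rfl
    congr 2 <;> omega
  rw [muR, first, second, last, nuR_eq_prod mu M t ht hodd hM, prod_Icc_symm _ hm]
  have hsplit (r : ℤ) : halfFactor t (clampRow (lamFull lam) M (k - m - 1) r - r) /
      halfFactor t (-r) = halfFactor t (M r - r) / halfFactor t (-r) * T r := by
    have h1 := ht (M r - r)
    have h2 := ht (-r)
    simp only [hT]
    field_simp
  simp only [hsplit, Finset.prod_mul_distrib]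
  ring

theorem clampRow_reflect (L M : ℤ → ℤ) (hL : ∀ r, L (-r) = -L r) (hM : ∀ r, M (-r) = -M r)
    (r : ℤ) (h : M r ≤ M (r - 1)) : -clampRow L M 0 (1 - r) = clampRow L M (-1) r := by
  have e1 := hL (r - 1)
  have e2 := hM (r - 1)
  have e3 := hM r
  unfold clampRow
  rw [show 1 - r + 0 = -(r - 1) by ring, show 1 - r - 1 = -r by ring,
    show 1 - r = -(r - 1) by ring, show r + -1 = r - 1 by ring]
  omega

theorem prod_halfFactor_neg_X (L M : ℤ → ℤ) (hL : ∀ r, L (-r) = -L r)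
    (hM : ∀ r, M (-r) = -M r) (m : ℤ) (h : ∀ r, -m ≤ r → r ≤ m + 1 → M r ≤ M (r - 1)) :
    ∏ r ∈ Finset.Icc (-m) (m + 1),
        halfFactor (-RatFunc.X) (clampRow L M 0 r - r) / halfFactor (-RatFunc.X) (-r)
      = ∏ r ∈ Finset.Icc (-m) (m + 1),
        halfFactor RatFunc.X (clampRow L M (-1) r - r) / halfFactor RatFunc.X (-r) := by
  refine Finset.prod_nbij' (fun r => 1 - r) (fun r => 1 - r) ?_ ?_ ?_ ?_ ?_
  · intro r
    simp only [Finset.mem_Icc]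
    omega
  · intro r
    simp only [Finset.mem_Icc]
    omega
  · intro r _
    ring
  · intro r _
    ring
  · intro r hr
    rw [Finset.mem_Icc] at hr
    have := clampRow_reflect L M hL hM (1 - r) (h _ (by omega) (by omega))
    rw [show 1 - (1 - r) = r by ring] at this
    rw [halfFactor_neg_X, halfFactor_neg_X, ← this]
    refine (neg_div_neg_eq _ _).trans ?_
    congr 2 <;> ring

theorem Pfun_one_symm {n m : ℤ} {lam mu : ℤ → ℤ} (hfin : (cells n m lam mu 1).Finite)
    (hsymm : ∀ q : ℤ × ℤ, q ∈ cells n m lam mu 1 → (1 - q.1, -1 - q.2) ∈ cells n m lam mu 1) :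
    Pfun n m lam mu 1 RatFunc.X = Pfun n m lam mu 1 (-RatFunc.X + 1) := by
  rw [Pfun_eq_prod hfin, Pfun_eq_prod hfin]
  have hsign : ∏ _q ∈ hfin.toFinset, (-1 : RatFunc ℂ) = 1 := by
    refine Finset.prod_involution (fun q _ => (1 - q.1, -1 - q.2)) ?_ ?_ ?_ ?_
    · intros
      ring
    · intro q _ _ h
      have := congrArg Prod.fst h
      simp only at this
      omega
    · intro q hq
      rw [Set.Finite.mem_toFinset] at hq ⊢
      exact hsymm q hq
    · intro q _
      ext <;> simp
  refine (mul_one _).symm.trans ?_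
  refine (congrArg _ hsign.symm).trans ?_
  rw [← Finset.prod_mul_distrib]
  refine Finset.prod_nbij' (fun q => (1 - q.1, -1 - q.2)) (fun q => (1 - q.1, -1 - q.2))
    ?_ ?_ ?_ ?_ ?_
  · intro q hq
    rw [Set.Finite.mem_toFinset] at hq ⊢
    exact hsymm q hq
  · intro q hq
    rw [Set.Finite.mem_toFinset] at hq ⊢
    exact hsymm q hq
  · intro q _
    ext <;> simp
  · intro q _
    ext <;> simp
  · intro q _
    rw [halfFactor_add_one, halfFactor_neg_X, mul_neg_one]
    congr 2
    ring

end TY18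


/-- **Statement 18** (Theorem 4.8): each cell set `Γ(μ) ∩ Γ(λ)^{(k-1)}`
(`k = 1,…,n-m`) is finite, and with
`P_k(u) = Π_α (u + c(α) + 1/2)` over these cells one has, as identities of
rational functions: `μ_{m+1}(-u)/μ_{m+1}(u) = P_1(u+1)/P_1(u)`,
`μ_{k-1}(u)/μ_k(u) = P_{k-m}(u+1)/P_{k-m}(u)` for `k = m+2,…,n`, and
`P_1(u) = P_1(-u+1)`; thus the `P_k` are the Drinfeld polynomials of the skew
representation `V(λ)⁺_μ` of `Y(sp_{2n-2m})`. -/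
theorem statement_18
    (n m : ℤ) (hm : 0 ≤ m) (hmn : m < n)
    (lam mu : ℤ → ℤ)
    (hlam0 : lam 1 ≤ 0) (hlam : ∀ i : ℤ, 1 ≤ i → i < n → lam (i+1) ≤ lam i)
    (hmu0 : mu 1 ≤ 0) (hmu : ∀ i : ℤ, 1 ≤ i → i < m → mu (i+1) ≤ mu i)
    (hcont1 : ∀ i : ℤ, 1 ≤ i → i ≤ m → lam (i+n-m) ≤ mu i)
    (hcont2 : ∀ i : ℤ, 1 ≤ i → i + n - m ≤ m → mu (i+n-m) ≤ lam i) :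
    (∀ k : ℤ, 1 ≤ k → k ≤ n - m → (cells n m lam mu k).Finite)
    ∧ (muR m lam mu (m+1) (-RatFunc.X) / muR m lam mu (m+1) RatFunc.X
        = Pfun n m lam mu 1 (RatFunc.X + 1) / Pfun n m lam mu 1 RatFunc.X)
    ∧ (∀ k : ℤ, m+2 ≤ k → k ≤ n →
        muR m lam mu (k-1) RatFunc.X / muR m lam mu k RatFunc.X
          = Pfun n m lam mu (k-m) (RatFunc.X + 1) / Pfun n m lam mu (k-m) RatFunc.X)
    ∧ Pfun n m lam mu 1 RatFunc.X = Pfun n m lam mu 1 (-RatFunc.X + 1) := by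
  have hL : ∀ a b : ℤ, -n ≤ a → a ≤ b → b ≤ n → lamFull lam b ≤ lamFull lam a :=
    fun a b ha hab hb => lamFull_anti hlam0 hlam ha hab hb
  have hlamn : lam n ≤ 0 := by
    have := hL 0 n (by omega) (by omega) le_rfl
    rwa [lamFull_zero, lamFull_of_pos _ (by omega)] at this
  set M := lamFull (extendBy m (lam n) mu) with hMdef
  have hodd : ∀ r, M (-r) = -M r := lamFull_neg _
  have hM : ∀ i, 1 ≤ i → i ≤ m → M i = mu i := fun i h1 h2 => by
    rw [hMdef, lamFull_of_pos _ h1, extendBy, if_pos h2]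
  have htop : M (m + 1) = lam n := by
    rw [hMdef, lamFull_of_pos _ (by omega), extendBy, if_neg (by omega)]
  have hanti : ∀ a b : ℤ, -(m + 1) ≤ a → a ≤ b → b ≤ m + 1 → M b ≤ M a := by
    refine fun a b ha hab hb => lamFull_anti ?_ ?_ ha hab hb
    · unfold extendBy
      split_ifs <;> assumption
    · intro i h1 h2
      unfold extendBy
      rcases eq_or_lt_of_le (show i ≤ m by omega) with rfl | h
      · rw [if_neg (by omega), if_pos le_rfl]
        have := hcont1 i h1 le_rfl
        rwa [show i + n - i = n by ring] at this
      · rw [if_pos (by omega), if_pos (by omega)]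
        exact hmu i h1 h
  have hMstep : ∀ r, -m ≤ r → r ≤ m + 1 → M r ≤ M (r - 1) := fun r h1 h2 =>
    hanti _ _ (by omega) (by omega) h2
  have hcells := fun (k : ℤ) (h1 : 1 ≤ k) (h2 : k ≤ n - m) =>
    mem_cells_iff hm lam mu hL h1 h2
  rw [← hMdef] at hcells
  have hfin : ∀ k : ℤ, 1 ≤ k → k ≤ n - m → (cells n m lam mu k).Finite := by
    intro k h1 h2
    refine ((Finset.Icc (-m) (m + 1)).sigma fun r => Finset.Ico
      (max (M r) (lamFull lam (r + (k - 1))))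
      (min (M (r - 1)) (lamFull lam (r + (k - 1) - 1)))).finite_toSet.image
        (fun s => (s.1, s.2)) |>.subset fun q hq => ?_
    exact ⟨⟨q.1, q.2⟩, by simpa using (hcells k h1 h2 q).mp hq, rfl⟩
  have hratio := fun (k : ℤ) (h1 : 1 ≤ k) (h2 : k ≤ n - m) =>
    Pfun_ratio (hfin k h1 h2) (lamFull lam) M (hcells k h1 h2)
      (fun r hr1 hr2 => hL _ _ (by omega) (by omega) (by omega)) hMstep
  have hmuX := fun (k : ℤ) (h1 : m + 1 ≤ k) (h2 : k ≤ n) =>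
    muR_eq_prod hm lam mu M RatFunc.X halfFactor_X_ne_zero hodd hM htop hanti hL h1 h2
  have hdiv (a b c : ℤ) : halfFactor RatFunc.X a / halfFactor RatFunc.X b /
      (halfFactor RatFunc.X c / halfFactor RatFunc.X b)
      = halfFactor RatFunc.X a / halfFactor RatFunc.X c :=
    div_div_div_cancel_right₀ (halfFactor_X_ne_zero b) _ _
  refine ⟨hfin, ?_, ?_, ?_⟩
  · rw [hratio 1 le_rfl (by omega), hmuX (m + 1) le_rfl (by omega),
      muR_eq_prod hm lam mu M (-RatFunc.X) halfFactor_neg_X_ne_zero hodd hM htop hanti hL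
        le_rfl (by omega), show m + 1 - m - 1 = 0 by ring,
      prod_halfFactor_neg_X _ _ (lamFull_neg lam) hodd m hMstep, ← Finset.prod_div_distrib]
    simp only [hdiv]
    norm_num
  · intro k h1 h2
    rw [hratio (k - m) (by omega) (by omega), hmuX k (by omega) h2,
      hmuX (k - 1) (by omega) (by omega), ← Finset.prod_div_distrib]
    simp only [hdiv]
    rw [show k - 1 - m - 1 = k - m - 1 - 1 by ring]
  · refine Pfun_one_symm (hfin 1 le_rfl (by omega)) fun q hq => ?_
    rw [hcells 1 le_rfl (by omega)] at hq ⊢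
    simp only [Finset.mem_Icc, Finset.mem_Ico, sub_self, add_zero] at hq ⊢
    have e1 := hodd (q.1 - 1)
    have e2 := hodd q.1
    have e3 := lamFull_neg lam (q.1 - 1)
    have e4 := lamFull_neg lam q.1
    rw [show 1 - q.1 - 1 = -q.1 by ring, show 1 - q.1 = -(q.1 - 1) by ring]
    omega
end
end
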